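/- arXiv:2312.09795 — 3 statements merged into one kernel-verified Lean document; each statement's English description precedes it below -/
import Mathlib

section
/- Let α be a real number with 1/2 < α ≤ 1 and let j₁, j₂, j₃, j₄ be integers satisfying j₁ + j₂ = j₃ + j₄ and |j₁|^{2α} + |j₂|^{2α} = |j₃|^{2α} + |j₄|^{2α}. Then either (j₁ = j₃ and j₂ = j₄) or (j₁ = j₄ and j₂ = j₃). -/
theorem strictConvexOn_abs_rpow {p : ℝ} (hp : 1 < p) :
    StrictConvexOn ℝ Set.univ fun x : ℝ => |x| ^ p := by
  refine ⟨convex_univ, fun x _ y _ hxy a b ha hb hab => ?_⟩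
  have hconv := strictConvexOn_rpow hp
  have hp0 : 0 < p := by linarith
  have hle : |a * x + b * y| ≤ a * |x| + b * |y| := by
    simpa [abs_mul, abs_of_pos ha, abs_of_pos hb] using abs_add_le (a * x) (b * y)
  simp only [smul_eq_mul]
  by_cases h : |x| = |y|
  · have hyx : x = -y := (abs_eq_abs.mp h).resolve_left hxy
    have hy : 0 < |y| := abs_pos.mpr fun hy => hxy (by simp [hyx, hy])
    have hlt : |a * x + b * y| < |y| := by
      have : a * x + b * y = (b - a) * y := by rw [hyx]; ring
      rw [this, abs_mul]
      have : |b - a| < 1 := abs_lt.mpr ⟨by linarith, by linarith⟩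
      nlinarith
    rw [h, ← add_mul, hab, one_mul]
    exact Real.rpow_lt_rpow (abs_nonneg _) hlt hp0
  · exact (Real.rpow_le_rpow (abs_nonneg _) hle hp0.le).trans_lt
      (hconv.2 (abs_nonneg x) (abs_nonneg y) h ha hb hab)

theorem StrictConvexOn.add_lt_add_of_add_eq_add {f : ℝ → ℝ} (hf : StrictConvexOn ℝ Set.univ f)
    {a b c d : ℝ} (hac : a < c) (hcb : c < b) (h : a + b = c + d) :
    f c + f d < f a + f b := by
  have hab : 0 < b - a := by linarith
  have hs : 0 < (b - c) / (b - a) := div_pos (by linarith) hab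
  have ht : 0 < (c - a) / (b - a) := div_pos (by linarith) hab
  have hst : (b - c) / (b - a) + (c - a) / (b - a) = 1 := by field_simp; ring
  have hc := hf.2 (Set.mem_univ a) (Set.mem_univ b) (by linarith) hs ht hst
  have hd := hf.2 (Set.mem_univ a) (Set.mem_univ b) (by linarith) ht hs (by linarith)
  simp only [smul_eq_mul] at hc hd
  have hceq : (b - c) / (b - a) * a + (c - a) / (b - a) * b = c := by field_simp; ring
  have hdeq : (c - a) / (b - a) * a + (b - c) / (b - a) * b = d := by
    rw [show d = a + b - c by linarith]; field_simp; ring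
  rw [hceq] at hc
  rw [hdeq] at hd
  calc f c + f d < ((b - c) / (b - a) + (c - a) / (b - a)) * (f a + f b) := by linarith
    _ = f a + f b := by rw [hst, one_mul]

theorem StrictConvexOn.eq_or_eq_of_add_eq_add {f : ℝ → ℝ} (hf : StrictConvexOn ℝ Set.univ f)
    {a b c d : ℝ} (h : a + b = c + d) (hfe : f a + f b = f c + f d) : a = c ∨ a = d := by
  by_contra! hne
  obtain ⟨hac, had⟩ := hne
  rcases lt_or_gt_of_ne hac with h₁ | h₁ <;> rcases lt_or_gt_of_ne had with h₂ | h₂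
  · linarith [hf.add_lt_add_of_add_eq_add h₁ (by linarith) h]
  · linarith [hf.add_lt_add_of_add_eq_add h₂ h₁ (show d + c = a + b by linarith)]
  · linarith [hf.add_lt_add_of_add_eq_add h₁ h₂ h.symm]
  · linarith [hf.add_lt_add_of_add_eq_add (show b < c by linarith) h₁
      (show b + a = c + d by linarith)]


/-- If `1/2 < α ≤ 1`, `j₁ + j₂ = j₃ + j₄` and
`|j₁|^{2α} + |j₂|^{2α} = |j₃|^{2α} + |j₄|^{2α}`, then `{j₁, j₂} = {j₃, j₄}`. -/
theorem statement_0 (α : ℝ) (hα₁ : 1/2 < α) (hα₂ : α ≤ 1) (j₁ j₂ j₃ j₄ : ℤ)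
    (hsum : j₁ + j₂ = j₃ + j₄)
    (hres : |(j₁ : ℝ)| ^ (2 * α) + |(j₂ : ℝ)| ^ (2 * α)
      = |(j₃ : ℝ)| ^ (2 * α) + |(j₄ : ℝ)| ^ (2 * α)) :
    (j₁ = j₃ ∧ j₂ = j₄) ∨ (j₁ = j₄ ∧ j₂ = j₃) := by
  have hsum' : (j₁ : ℝ) + j₂ = j₃ + j₄ := by exact_mod_cast hsum
  rcases (strictConvexOn_abs_rpow (by linarith : 1 < 2 * α)).eq_or_eq_of_add_eq_add
    hsum' hres with h | h
  · have : j₁ = j₃ := by exact_mod_cast h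
    omega
  · have : j₁ = j₄ := by exact_mod_cast h
    omega
end

section
/- Let s ≥ 0 and N ∈ ℕ ∪ {∞}. There is a constant C_s > 0, depending only on s, such that for all sequences u, v, φ : ℤ → ℂ with finite H^s norms one has ∑_{n∈ℤ} ⟨n⟩^{2s} ( ∑ |u(j₁)| |v(j₂)| |φ(j₃)| / (2 |j₃ − j₂| |j₁ − j₃|) )² ≤ C_s ( ‖u‖_{H^s} ‖v‖_{L²} ‖φ‖_{L²} + ‖u‖_{L²} ‖v‖_{H^s} ‖φ‖_{L²} + ‖u‖_{L²} ‖v‖_{L²} ‖φ‖_{H^s} )², where the inner sum runs over integers j₁, j₂, j₃ with j₁ + j₂ − j₃ = n, j₂ ≠ j₃, j₁ ≠ j₃ and |j₁|, |j₂|, |j₃| ≤ N (the constraints |jᵢ| ≤ N being absent when N = ∞). -/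
open scoped BigOperators ENNReal ComplexConjugate Classical
open Filter Set MeasureTheory ComplexConjugate

noncomputable section

/-- `ℝ≥0∞`-valued `H^s` norm of a sequence of Fourier coefficients. -/
def hsE (s : ℝ) (u : ℤ → ℂ) : ℝ≥0∞ :=
  (∑' n : ℤ, ENNReal.ofReal (1 + |(n : ℝ)| ^ (2 * s)) * (‖u n‖₊ : ℝ≥0∞) ^ 2) ^ ((1:ℝ)/2)

/-- `ℝ≥0∞`-valued `FL^{0,1}` norm. -/
def flE (u : ℤ → ℂ) : ℝ≥0∞ := ∑' n : ℤ, (‖u n‖₊ : ℝ≥0∞)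

/-- real-valued `H^s` norm. -/
def hsR (s : ℝ) (u : ℤ → ℂ) : ℝ :=
  Real.sqrt (∑' n : ℤ, (1 + |(n : ℝ)| ^ (2 * s)) * ‖u n‖ ^ 2)

/-- real-valued `FL^{0,1}` norm. -/
def flR (u : ℤ → ℂ) : ℝ := ∑' n : ℤ, ‖u n‖

/-- The condition `|j| ≤ N` for `N ∈ ℕ ∪ {∞}`. -/
def inBall (N : ℕ∞) (j : ℤ) : Prop := (j.natAbs : ℕ∞) ≤ N

/-- The resonance function `Φ_α`. -/
def res (α : ℝ) (j₁ j₂ j₃ : ℤ) : ℝ :=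
  |(j₁ : ℝ)| ^ (2 * α) + |(j₂ : ℝ)| ^ (2 * α) - |(j₃ : ℝ)| ^ (2 * α)
    - |((j₁ + j₂ - j₃ : ℤ) : ℝ)| ^ (2 * α)

/-- The (truncated) Birkhoff vector field `X_N`. -/
def XB (α σ : ℝ) (N : ℕ∞) (u : ℤ → ℂ) : ℤ → ℂ := fun n =>
  if inBall N n then
    ∑' p : ℤ × ℤ,
      (if inBall N p.1 ∧ inBall N p.2 ∧ inBall N (p.1 + p.2 - n) ∧
          res α p.1 p.2 (p.1 + p.2 - n) ≠ 0 then
        ((-σ / res α p.1 p.2 (p.1 + p.2 - n) : ℝ) : ℂ) *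
          (u p.1 * u p.2 * conj (u (p.1 + p.2 - n)))
      else 0)
  else 0

/-- Truncation `Π_N`. -/
def trunc (N : ℕ) (u : ℤ → ℂ) : ℤ → ℂ := fun n => if n.natAbs ≤ N then u n else 0

/-- Derivative of a curve at `t`, in the `H^s` norm. -/
def HasHsDerivAt (s : ℝ) (u : ℝ → ℤ → ℂ) (d : ℤ → ℂ) (t : ℝ) : Prop :=
  Tendsto (fun h : ℝ => hsE s (fun n => (u (t + h) n - u t n) / (h : ℂ) - d n))
    (nhdsWithin 0 {(0 : ℝ)}ᶜ) (nhds 0)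

/-- Derivative of a curve at `t` within a set `A` of times, in the `H^s` norm. -/
def HasHsDerivWithinAt (s : ℝ) (u : ℝ → ℤ → ℂ) (d : ℤ → ℂ) (A : Set ℝ) (t : ℝ) : Prop :=
  Tendsto (fun h : ℝ => hsE s (fun n => (u (t + h) n - u t n) / (h : ℂ) - d n))
    (nhdsWithin 0 {h : ℝ | t + h ∈ A ∧ h ≠ 0}) (nhds 0)

/-- Continuity of a curve in the `H^s` norm. -/
def ContHs (s : ℝ) (D : ℝ → ℤ → ℂ) : Prop :=
  ∀ t : ℝ, Tendsto (fun t' => hsE s (fun n => D t' n - D t n)) (nhds t) (nhds 0)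

/-- Continuity of a curve in the `H^s` norm, on a set of times. -/
def ContHsOn (s : ℝ) (A : Set ℝ) (D : ℝ → ℤ → ℂ) : Prop :=
  ∀ t ∈ A, Tendsto (fun t' => hsE s (fun n => D t' n - D t n)) (nhdsWithin t A) (nhds 0)

/-- `u` is a global-in-time solution of `d/dt u = X_N(u)`, as a curve in `H^s`. -/
def IsSol (α σ : ℝ) (N : ℕ∞) (s : ℝ) (u : ℝ → ℤ → ℂ) : Prop :=
  ∀ t : ℝ, hsE s (u t) ≠ ⊤ ∧ HasHsDerivAt s u (XB α σ N (u t)) t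

/-- `u` solves `d/dt u = X_N(u)` on the set of times `A`, as a curve in `H^s`. -/
def IsSolOn (α σ : ℝ) (N : ℕ∞) (s : ℝ) (A : Set ℝ) (u : ℝ → ℤ → ℂ) : Prop :=
  ∀ t ∈ A, hsE s (u t) ≠ ⊤ ∧ HasHsDerivWithinAt s u (XB α σ N (u t)) A t

/-- `u` is a global-in-time continuously differentiable solution, as a curve in `H^s`. -/
def IsC1Sol (α σ : ℝ) (N : ℕ∞) (s : ℝ) (u : ℝ → ℤ → ℂ) : Prop :=
  IsSol α σ N s u ∧ ContHs s (fun t => XB α σ N (u t))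

/-- `u` is a continuously differentiable solution on the set of times `A`. -/
def IsC1SolOn (α σ : ℝ) (N : ℕ∞) (s : ℝ) (A : Set ℝ) (u : ℝ → ℤ → ℂ) : Prop :=
  IsSolOn α σ N s A u ∧ ContHsOn s A (fun t => XB α σ N (u t))

/-- integer modes in `[-N, N]`. -/
def Ifin (N : ℕ) : Finset ℤ := Finset.Icc (-(N:ℤ)) (N:ℤ)

/-- The quartic form `‖Π_N u‖⁴_{L⁴}`. -/
def qL4 (N : ℕ) (u : ℤ → ℂ) : ℝ :=
  (∑ j₁ ∈ Ifin N, ∑ j₂ ∈ Ifin N, ∑ j₃ ∈ Ifin N, ∑ j₄ ∈ Ifin N,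
    if j₁ + j₂ = j₃ + j₄ then u j₁ * u j₂ * conj (u j₃) * conj (u j₄) else 0).re

/-- `G_N(u)`, the derivative at `t = 0` of the energy along the truncated Birkhoff flow. -/
def GN (α σ : ℝ) (N : ℕ) (u : ℤ → ℂ) : ℝ :=
  -(σ/2) * qL4 N u + σ * (∑ j ∈ Ifin N, ‖u j‖^2)^2
  + 2 * σ * (∑ n₁ ∈ Ifin N, ∑ n₂ ∈ Ifin N, ∑ m₁ ∈ Ifin N, ∑ m₂ ∈ Ifin N,
      if n₁ + n₂ = m₁ + m₂ then
        XB α σ (N : ℕ∞) (trunc N u) n₁ * u n₂ * conj (u m₁) * conj (u m₂)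
      else 0).re


/-- Cauchy–Schwarz for sums in `ℝ≥0∞`. -/
theorem ENNReal.tsum_mul_sq_le {ι : Type*} (f g : ι → ℝ≥0∞) :
    (∑' i, f i * g i) ^ 2 ≤ (∑' i, f i ^ 2) * ∑' i, g i ^ 2 := by
  let _ : MeasurableSpace ι := ⊤
  have h := ENNReal.lintegral_mul_le_Lp_mul_Lq (Measure.count : Measure ι)
    Real.HolderConjugate.two_two (f := f) (g := g)
    (measurable_from_top.aemeasurable) (measurable_from_top.aemeasurable)
  simp only [lintegral_count, Pi.mul_apply, ENNReal.rpow_two] at h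
  have hsq : ∀ x : ℝ≥0∞, (x ^ ((1 : ℝ) / 2)) ^ 2 = x := fun x => by
    rw [← ENNReal.rpow_natCast, ← ENNReal.rpow_mul]; norm_num
  calc _ ≤ _ := pow_le_pow_left' h 2
    _ = _ := by rw [mul_pow, hsq, hsq]

theorem ENNReal.tsum_tsum_mul_mul_convolution (f g h : ℤ → ℝ≥0∞) :
    ∑' n : ℤ, ∑' p : ℤ × ℤ, f p.1 * g p.2 * h (p.1 + p.2 - n)
      = (∑' j, f j) * (∑' j, g j) * ∑' j, h j := by
  rw [ENNReal.tsum_comm]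
  have hn : ∀ p : ℤ × ℤ, ∑' n : ℤ, f p.1 * g p.2 * h (p.1 + p.2 - n)
      = f p.1 * g p.2 * ∑' j, h j := fun p => by
    rw [ENNReal.tsum_mul_left]
    exact congrArg _ ((Equiv.subLeft (p.1 + p.2)).tsum_eq h)
  simp_rw [hn, ENNReal.tsum_mul_right]
  congr 1
  rw [ENNReal.tsum_prod (f := fun a b => f a * g b)]
  simp_rw [ENNReal.tsum_mul_left, ENNReal.tsum_mul_right]

theorem ENNReal.sq_add_sq_add_sq_le_add_sq (a b c : ℝ≥0∞) :
    a ^ 2 + b ^ 2 + c ^ 2 ≤ (a + b + c) ^ 2 :=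
  calc a ^ 2 + b ^ 2 + c ^ 2 ≤ a ^ 2 + b ^ 2 + c ^ 2 + 2 * (a * b + a * c + b * c) :=
        le_self_add
    _ = (a + b + c) ^ 2 := by ring

theorem hsE_sq (s : ℝ) (u : ℤ → ℂ) :
    hsE s u ^ 2 = ∑' n : ℤ, ENNReal.ofReal (1 + |(n : ℝ)| ^ (2 * s)) * (‖u n‖₊ : ℝ≥0∞) ^ 2 := by
  rw [hsE, ← ENNReal.rpow_natCast, ← ENNReal.rpow_mul]
  norm_num

theorem tsum_sq_le_hsE_zero_sq (u : ℤ → ℂ) :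
    ∑' n : ℤ, (‖u n‖₊ : ℝ≥0∞) ^ 2 ≤ hsE 0 u ^ 2 := by
  rw [hsE_sq]
  refine ENNReal.tsum_le_tsum fun n => le_mul_of_one_le_left' ?_
  rw [ENNReal.one_le_ofReal]
  simp

theorem japanese_rpow_le_of_sq_le {s : ℝ} (hs : 0 ≤ s) {x y : ℝ} (h : x ^ 2 ≤ 9 * y ^ 2) :
    (1 + x ^ 2) ^ s ≤ 18 ^ s * (1 + |y| ^ (2 * s)) := by
  have hy : |y| ^ (2 * s) = (y ^ 2) ^ s := by
    rw [Real.rpow_mul (abs_nonneg y), Real.rpow_two, sq_abs]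
  have h18 : (0 : ℝ) ≤ 18 ^ s := by positivity
  rw [hy]
  rcases le_total (y ^ 2) 1 with h1 | h1
  · calc (1 + x ^ 2) ^ s ≤ 18 ^ s := Real.rpow_le_rpow (by positivity) (by linarith) hs
      _ ≤ _ := le_mul_of_one_le_right h18 (le_add_of_nonneg_right (by positivity))
  · calc (1 + x ^ 2) ^ s ≤ (18 * y ^ 2) ^ s :=
          Real.rpow_le_rpow (by positivity) (by linarith) hs
      _ = 18 ^ s * (y ^ 2) ^ s := Real.mul_rpow (by norm_num) (by positivity)
      _ ≤ _ := mul_le_mul_of_nonneg_left (by linarith) h18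

theorem japanese_rpow_add_sub_le {s : ℝ} (hs : 0 ≤ s) (a b c : ℝ) :
    (1 + (a + b - c) ^ 2) ^ s
      ≤ 18 ^ s * ((1 + |a| ^ (2 * s)) + (1 + |b| ^ (2 * s)) + (1 + |c| ^ (2 * s))) := by
  have hA : 0 ≤ (18 : ℝ) ^ s * (1 + |a| ^ (2 * s)) := by positivity
  have hB : 0 ≤ (18 : ℝ) ^ s * (1 + |b| ^ (2 * s)) := by positivity
  have hC : 0 ≤ (18 : ℝ) ^ s * (1 + |c| ^ (2 * s)) := by positivity
  have key : (a + b - c) ^ 2 ≤ 3 * (a ^ 2 + b ^ 2 + c ^ 2) := by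
    nlinarith [sq_nonneg (a - b), sq_nonneg (a + c), sq_nonneg (b + c)]
  have hmax : (a + b - c) ^ 2 ≤ 9 * a ^ 2 ∨ (a + b - c) ^ 2 ≤ 9 * b ^ 2 ∨
      (a + b - c) ^ 2 ≤ 9 * c ^ 2 := by
    by_contra! h
    linarith [h.1, h.2.1, h.2.2]
  rcases hmax with h | h | h <;> linarith [japanese_rpow_le_of_sq_le hs h]

/-- The kernel `1/|m|`, with value `0` at `m = 0`. -/
def invAbs (m : ℤ) : ℝ≥0∞ := ENNReal.ofReal (1 / |(m : ℝ)|)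

theorem tsum_invAbs_sq : ∑' m : ℤ, invAbs m ^ 2 = ENNReal.ofReal (∑' m : ℤ, 1 / (m : ℝ) ^ 2) := by
  rw [ENNReal.ofReal_tsum_of_nonneg (fun m => by positivity)
    (Real.summable_one_div_int_pow.mpr one_lt_two)]
  refine tsum_congr fun m => ?_
  rw [invAbs, ← ENNReal.ofReal_pow (by positivity), div_pow, one_pow, sq_abs]

theorem tsum_invAbs_sub_sq (n : ℤ) :
    ∑' p : ℤ × ℤ, (invAbs (p.1 - n) * invAbs (p.2 - n)) ^ 2 = (∑' m : ℤ, invAbs m ^ 2) ^ 2 := by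
  have h : ∑' j : ℤ, invAbs (j - n) ^ 2 = ∑' m : ℤ, invAbs m ^ 2 :=
    (Equiv.subRight n).tsum_eq fun m => invAbs m ^ 2
  simp_rw [mul_pow]
  rw [ENNReal.tsum_prod (f := fun a b => invAbs (a - n) ^ 2 * invAbs (b - n) ^ 2)]
  simp_rw [ENNReal.tsum_mul_left, ENNReal.tsum_mul_right, h, sq]

theorem ofReal_trilinear_kernel_le (x y z : ℂ) (k l : ℤ) :
    ENNReal.ofReal (‖x‖ * ‖y‖ * ‖z‖ / (2 * |(k : ℝ)| * |(l : ℝ)|))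
      ≤ invAbs k * invAbs l * (‖x‖₊ * ‖y‖₊ * ‖z‖₊) := by
  have hc : ∀ w : ℂ, (‖w‖₊ : ℝ≥0∞) = ENNReal.ofReal ‖w‖ := fun w => by
    rw [ofReal_norm]; rfl
  rw [hc, hc, hc, invAbs, invAbs, ← ENNReal.ofReal_mul (by positivity),
    ← ENNReal.ofReal_mul (by positivity), ← ENNReal.ofReal_mul (by positivity),
    ← ENNReal.ofReal_mul (by positivity)]
  refine ENNReal.ofReal_le_ofReal ?_
  have h : ‖x‖ * ‖y‖ * ‖z‖ / (2 * |(k : ℝ)| * |(l : ℝ)|)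
      = 1 / 2 * (1 / |(k : ℝ)| * (1 / |(l : ℝ)|) * (‖x‖ * ‖y‖ * ‖z‖)) := by
    simp only [div_eq_mul_inv, mul_inv]; ring
  have h0 : 0 ≤ 1 / |(k : ℝ)| * (1 / |(l : ℝ)|) * (‖x‖ * ‖y‖ * ‖z‖) := by positivity
  linarith

/-- The weighted trilinear sum of squares splits into products of `H^s` and `L²` norms. -/
theorem tsum_weighted_trilinear_sq_le {s : ℝ} (hs : 0 ≤ s) (u v φ : ℤ → ℂ) :
    ∑' n : ℤ, ENNReal.ofReal ((1 + (n : ℝ) ^ 2) ^ s) * ∑' p : ℤ × ℤ,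
        ((‖u p.1‖₊ : ℝ≥0∞) * ‖v p.2‖₊ * ‖φ (p.1 + p.2 - n)‖₊) ^ 2
      ≤ ENNReal.ofReal (18 ^ s) * (hsE s u * hsE 0 v * hsE 0 φ + hsE 0 u * hsE s v * hsE 0 φ
            + hsE 0 u * hsE 0 v * hsE s φ) ^ 2 := by
  set W : ℤ → ℝ≥0∞ := fun j => ENNReal.ofReal (1 + |(j : ℝ)| ^ (2 * s)) with hW
  set U : ℤ → ℝ≥0∞ := fun j => (‖u j‖₊ : ℝ≥0∞) ^ 2 with hU
  set V : ℤ → ℝ≥0∞ := fun j => (‖v j‖₊ : ℝ≥0∞) ^ 2 with hV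
  set P : ℤ → ℝ≥0∞ := fun j => (‖φ j‖₊ : ℝ≥0∞) ^ 2 with hP
  have hw : ∀ n a b : ℤ, ENNReal.ofReal ((1 + (n : ℝ) ^ 2) ^ s)
      ≤ ENNReal.ofReal (18 ^ s) * (W a + W b + W (a + b - n)) := fun n a b => by
    rw [hW, ← ENNReal.ofReal_add (by positivity) (by positivity),
      ← ENNReal.ofReal_add (by positivity) (by positivity), ← ENNReal.ofReal_mul (by positivity)]
    refine ENNReal.ofReal_le_ofReal ?_
    have h := japanese_rpow_add_sub_le hs a b ((a + b - n : ℤ) : ℝ)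
    rwa [show (a : ℝ) + b - ((a + b - n : ℤ) : ℝ) = n by push_cast; ring] at h
  calc _ ≤ ∑' n : ℤ, ENNReal.ofReal (18 ^ s) * ∑' p : ℤ × ℤ,
          ((W p.1 * U p.1) * V p.2 * P (p.1 + p.2 - n)
            + U p.1 * (W p.2 * V p.2) * P (p.1 + p.2 - n)
            + U p.1 * V p.2 * (W (p.1 + p.2 - n) * P (p.1 + p.2 - n))) := by
        refine ENNReal.tsum_le_tsum fun n => ?_
        rw [← ENNReal.tsum_mul_left, ← ENNReal.tsum_mul_left]
        refine ENNReal.tsum_le_tsum fun p => (mul_le_mul_left (hw n p.1 p.2) _).trans_eq ?_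
        simp only [hU, hV, hP]
        ring
    _ = ENNReal.ofReal (18 ^ s) *
          (hsE s u ^ 2 * (∑' j, V j) * (∑' j, P j) + (∑' j, U j) * hsE s v ^ 2 * (∑' j, P j)
            + (∑' j, U j) * (∑' j, V j) * hsE s φ ^ 2) := by
        simp_rw [ENNReal.tsum_mul_left, ENNReal.tsum_add, hsE_sq]
        rw [ENNReal.tsum_tsum_mul_mul_convolution (fun j => W j * U j) V P,
          ENNReal.tsum_tsum_mul_mul_convolution U (fun j => W j * V j) P,
          ENNReal.tsum_tsum_mul_mul_convolution U V (fun j => W j * P j)]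
    _ ≤ ENNReal.ofReal (18 ^ s) *
          (hsE s u ^ 2 * hsE 0 v ^ 2 * hsE 0 φ ^ 2 + hsE 0 u ^ 2 * hsE s v ^ 2 * hsE 0 φ ^ 2
            + hsE 0 u ^ 2 * hsE 0 v ^ 2 * hsE s φ ^ 2) := by
        have h1 := tsum_sq_le_hsE_zero_sq u
        have h2 := tsum_sq_le_hsE_zero_sq v
        have h3 := tsum_sq_le_hsE_zero_sq φ
        gcongr
    _ ≤ _ := by
        refine mul_le_mul_right ?_ _
        simp only [← mul_pow]
        exact ENNReal.sq_add_sq_add_sq_le_add_sq _ _ _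

/-- Trilinear estimate for the cubic NLS (`α = 1`) Birkhoff kernel `1/(2|j₃-j₂||j₁-j₃|)`. -/
theorem statement_2 (s : ℝ) (hs : 0 ≤ s) :
    ∃ C : ℝ, 0 < C ∧ ∀ N : ℕ∞, ∀ u v φ : ℤ → ℂ,
      hsE s u ≠ ⊤ → hsE s v ≠ ⊤ → hsE s φ ≠ ⊤ →
      (∑' n : ℤ, ENNReal.ofReal ((1 + (n : ℝ) ^ 2) ^ s) *
        (∑' p : ℤ × ℤ,
          if p.2 ≠ p.1 + p.2 - n ∧ p.1 ≠ p.1 + p.2 - n ∧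
              inBall N p.1 ∧ inBall N p.2 ∧ inBall N (p.1 + p.2 - n) then
            ENNReal.ofReal (‖u p.1‖ * ‖v p.2‖ * ‖φ (p.1 + p.2 - n)‖ /
              (2 * |((p.1 + p.2 - n - p.2 : ℤ) : ℝ)| * |((p.1 - (p.1 + p.2 - n) : ℤ) : ℝ)|))
          else 0) ^ 2)
      ≤ ENNReal.ofReal C *
          (hsE s u * hsE 0 v * hsE 0 φ + hsE 0 u * hsE s v * hsE 0 φ
            + hsE 0 u * hsE 0 v * hsE s φ) ^ 2 := by
  set T : ℝ := ∑' m : ℤ, 1 / (m : ℝ) ^ 2 with hT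
  have hT0 : 0 ≤ T := tsum_nonneg fun m => by positivity
  refine ⟨(T + 1) ^ 2 * 18 ^ s, by positivity, fun N u v φ _ _ _ => ?_⟩
  have hS : (∑' m : ℤ, invAbs m ^ 2) ^ 2 ≤ ENNReal.ofReal ((T + 1) ^ 2) := by
    rw [tsum_invAbs_sq, ← ENNReal.ofReal_pow hT0]
    exact ENNReal.ofReal_le_ofReal (pow_le_pow_left₀ hT0 (by linarith) 2)
  rw [ENNReal.ofReal_mul (by positivity), mul_assoc]
  refine le_trans ?_ (mul_le_mul_right (tsum_weighted_trilinear_sq_le hs u v φ) _)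
  rw [← ENNReal.tsum_mul_left]
  refine ENNReal.tsum_le_tsum fun n => ?_
  rw [mul_left_comm]
  refine mul_le_mul_right ?_ _
  refine le_trans (pow_le_pow_left' (ENNReal.tsum_le_tsum fun p => ?_) 2)
    ((ENNReal.tsum_mul_sq_le (fun p : ℤ × ℤ => invAbs (p.1 - n) * invAbs (p.2 - n)) _).trans
      (mul_le_mul_left ((tsum_invAbs_sub_sq n).trans_le hS) _))
  split_ifs
  · rw [show p.1 + p.2 - n - p.2 = p.1 - n by ring,
      show p.1 - (p.1 + p.2 - n) = -(p.2 - n) by ring, Int.cast_neg, abs_neg]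
    exact ofReal_trilinear_kernel_le _ _ _ _ _
  · exact zero_le

end
end

section
/- Let α = 1, σ ∈ {−1, +1}, N ∈ ℕ ∪ {∞} and s ≥ 0. There is a constant C_s > 0, depending only on s, such that for all sequences u, v : ℤ → ℂ with finite H^s norms: (i) ‖X_N(u)‖_{H^s} ≤ C_s ‖u‖_{L²}² ‖u‖_{H^s}; (ii) ‖X_N(u) − X_N(v)‖_{H^s} ≤ C_s ‖u − v‖_{H^s} ( ‖u‖_{H^s}² + ‖v‖_{H^s}² ). -/
open scoped BigOperators ENNReal ComplexConjugate Classical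
open Filter Set MeasureTheory ComplexConjugate

noncomputable section

/-- The weight `1 + |n|^{2s}` of the `H^s` norm. -/
def sobolevWeight (s : ℝ) (n : ℤ) : ℝ≥0∞ := ENNReal.ofReal (1 + |(n : ℝ)| ^ (2 * s))

/-- The square of the `H^s` norm of a nonnegative sequence. -/
def sobolevEnergy (s : ℝ) (F : ℤ → ℝ≥0∞) : ℝ≥0∞ := ∑' n, sobolevWeight s n * F n ^ 2

/-- The singular kernel `1 / |n|`, vanishing at `n = 0`. -/
def invKernel (n : ℤ) : ℝ≥0∞ := ‖(n : ℝ)⁻¹‖ₑ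

/-- The positive trilinear form dominating the Birkhoff vector field for `α = 1`. -/
def cubicMajorant (F G H : ℤ → ℝ≥0∞) (n : ℤ) : ℝ≥0∞ :=
  ∑' p : ℤ × ℤ, invKernel (p.1 - n) * invKernel (p.2 - n) *
    (F p.1 * G p.2 * H (p.1 + p.2 - n))

/-- The cubic summand of the Birkhoff vector field at output frequency `n`. -/
def birkhoffTerm (α σ : ℝ) (N : ℕ∞) (u : ℤ → ℂ) (n : ℤ) (p : ℤ × ℤ) : ℂ :=
  if inBall N p.1 ∧ inBall N p.2 ∧ inBall N (p.1 + p.2 - n) ∧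
      res α p.1 p.2 (p.1 + p.2 - n) ≠ 0 then
    ((-σ / res α p.1 p.2 (p.1 + p.2 - n) : ℝ) : ℂ) *
      (u p.1 * u p.2 * conj (u (p.1 + p.2 - n)))
  else 0

theorem XB_eq_tsum (α σ : ℝ) (N : ℕ∞) (u : ℤ → ℂ) (n : ℤ) :
    XB α σ N u n = if inBall N n then ∑' p, birkhoffTerm α σ N u n p else 0 := rfl

theorem hsE_sq_s3 (s : ℝ) (u : ℤ → ℂ) : hsE s u ^ 2 = sobolevEnergy s (fun n => ‖u n‖ₑ) := by
  unfold hsE sobolevEnergy sobolevWeight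
  rw [← ENNReal.rpow_natCast, ← ENNReal.rpow_mul]
  norm_num
  rfl

theorem tsum_invKernel_sq_ne_top : ∑' n, invKernel n ^ 2 ≠ ⊤ := by
  have h : ∀ n : ℤ, invKernel n ^ 2 = ENNReal.ofReal (1 / (n : ℝ) ^ 2) := fun n => by
    rw [invKernel, ← ofReal_norm, ← ENNReal.ofReal_pow (norm_nonneg _), Real.norm_eq_abs, sq_abs,
      inv_pow, one_div]
  simp only [h]
  exact (Real.summable_one_div_int_pow.2 (by norm_num)).tsum_ofReal_ne_top

theorem one_le_sobolevWeight (s : ℝ) (n : ℤ) : 1 ≤ sobolevWeight s n := by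
  rw [sobolevWeight, ENNReal.one_le_ofReal]
  have := Real.rpow_nonneg (abs_nonneg (n : ℝ)) (2 * s)
  linarith

theorem tsum_sq_le_sobolevEnergy (s : ℝ) (F : ℤ → ℝ≥0∞) :
    ∑' n, F n ^ 2 ≤ sobolevEnergy s F :=
  ENNReal.tsum_le_tsum fun n => le_mul_of_one_le_left' (one_le_sobolevWeight s n)

theorem le_sobolevEnergy (s : ℝ) (F : ℤ → ℝ≥0∞) (n : ℤ) : F n ^ 2 ≤ sobolevEnergy s F :=
  (ENNReal.le_tsum n).trans (tsum_sq_le_sobolevEnergy s F)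

theorem sobolevEnergy_mono (s : ℝ) {F G : ℤ → ℝ≥0∞} (h : ∀ n, F n ≤ G n) :
    sobolevEnergy s F ≤ sobolevEnergy s G :=
  ENNReal.tsum_le_tsum fun n => by gcongr; exact h n

theorem ENNReal.add_add_sq_le (a b c : ℝ≥0∞) :
    (a + b + c) ^ 2 ≤ 3 * (a ^ 2 + b ^ 2 + c ^ 2) := by
  have h := ENNReal.rpow_sum_le_const_mul_sum_rpow (Finset.univ : Finset (Fin 3)) ![a, b, c]
    (p := 2) (by norm_num)
  norm_num [Fin.sum_univ_three] at h
  exact h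

theorem sobolevEnergy_add_add_le (s : ℝ) (F G H : ℤ → ℝ≥0∞) :
    sobolevEnergy s (fun n => F n + G n + H n) ≤
      3 * (sobolevEnergy s F + sobolevEnergy s G + sobolevEnergy s H) := by
  simp only [sobolevEnergy]
  rw [← ENNReal.tsum_add, ← ENNReal.tsum_add, ← ENNReal.tsum_mul_left]
  refine ENNReal.tsum_le_tsum fun n => ?_
  calc sobolevWeight s n * (F n + G n + H n) ^ 2
      ≤ sobolevWeight s n * (3 * (F n ^ 2 + G n ^ 2 + H n ^ 2)) := by
        gcongr; exact ENNReal.add_add_sq_le _ _ _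
    _ = _ := by ring

theorem sobolevWeight_add_sub_le {s : ℝ} (hs : 0 ≤ s) (p q r : ℤ) :
    sobolevWeight s (p + q - r) ≤
      ENNReal.ofReal (9 ^ s) * (sobolevWeight s p + sobolevWeight s q + sobolevWeight s r) := by
  have hnn : ∀ n : ℤ, 0 ≤ |(n : ℝ)| ^ (2 * s) := fun n => Real.rpow_nonneg (abs_nonneg _) _
  have h9 : (1 : ℝ) ≤ 9 ^ s := Real.one_le_rpow (by norm_num) hs
  have hp := hnn p
  have hq := hnn q
  have hr := hnn r
  have key : ∀ m : ℤ, |(p : ℝ)| ≤ |(m : ℝ)| → |(q : ℝ)| ≤ |(m : ℝ)| → |(r : ℝ)| ≤ |(m : ℝ)| →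
      |((p + q - r : ℤ) : ℝ)| ^ (2 * s) ≤ 9 ^ s * |(m : ℝ)| ^ (2 * s) := fun m h1 h2 h3 => by
    have hb : |((p + q - r : ℤ) : ℝ)| ≤ 3 * |(m : ℝ)| := by
      push_cast
      have := abs_sub ((p : ℝ) + q) r
      have := abs_add_le (p : ℝ) q
      linarith
    calc |((p + q - r : ℤ) : ℝ)| ^ (2 * s) ≤ (3 * |(m : ℝ)|) ^ (2 * s) :=
          Real.rpow_le_rpow (abs_nonneg _) hb (by linarith)
      _ = 9 ^ s * |(m : ℝ)| ^ (2 * s) := by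
          rw [Real.mul_rpow (by norm_num) (abs_nonneg _), Real.rpow_mul (by norm_num : (0 : ℝ) ≤ 3)]
          norm_num
  have main : |((p + q - r : ℤ) : ℝ)| ^ (2 * s) ≤
      9 ^ s * (|(p : ℝ)| ^ (2 * s) + |(q : ℝ)| ^ (2 * s) + |(r : ℝ)| ^ (2 * s)) := by
    rcases le_total |(p : ℝ)| |(q : ℝ)| with h1 | h1 <;>
    rcases le_total |(q : ℝ)| |(r : ℝ)| with h2 | h2 <;>
    rcases le_total |(p : ℝ)| |(r : ℝ)| with h3 | h3
    all_goals first
      | exact (key p le_rfl (by linarith) (by linarith)).trans (by gcongr; linarith)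
      | exact (key q (by linarith) le_rfl (by linarith)).trans (by gcongr; linarith)
      | exact (key r (by linarith) (by linarith) le_rfl).trans (by gcongr; linarith)
  unfold sobolevWeight
  rw [← ENNReal.ofReal_add (by linarith) (by linarith),
    ← ENNReal.ofReal_add (by linarith) (by linarith), ← ENNReal.ofReal_mul (by linarith)]
  exact ENNReal.ofReal_le_ofReal (by nlinarith)

theorem tsum_invKernel_translates (n : ℤ) :
    ∑' p : ℤ × ℤ, (invKernel (p.1 - n) * invKernel (p.2 - n)) ^ 2 =
      (∑' m, invKernel m ^ 2) ^ 2 := by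
  rw [ENNReal.tsum_prod']
  simp only [mul_pow, ENNReal.tsum_mul_left, ENNReal.tsum_mul_right]
  have h : ∑' a, invKernel (a - n) ^ 2 = ∑' m, invKernel m ^ 2 :=
    (Equiv.subRight n).tsum_eq (fun m => invKernel m ^ 2)
  rw [h, sq]

theorem cubicMajorant_sq_le (F G H : ℤ → ℝ≥0∞) (n : ℤ) :
    cubicMajorant F G H n ^ 2 ≤ (∑' m, invKernel m ^ 2) ^ 2 *
      ∑' p : ℤ × ℤ, (F p.1 * G p.2 * H (p.1 + p.2 - n)) ^ 2 := by
  rw [← tsum_invKernel_translates n]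
  exact ENNReal.tsum_mul_sq_le _ _

theorem tsum_tsum_add_sub (A B D : ℤ → ℝ≥0∞) :
    ∑' n : ℤ, ∑' p : ℤ × ℤ, A p.1 * B p.2 * D (p.1 + p.2 - n) =
      (∑' n, A n) * (∑' n, B n) * ∑' n, D n := by
  rw [ENNReal.tsum_comm]
  have h : ∀ p : ℤ × ℤ, ∑' n, A p.1 * B p.2 * D (p.1 + p.2 - n) =
      A p.1 * B p.2 * ∑' n, D n := fun p => by
    rw [ENNReal.tsum_mul_left, ← (Equiv.subLeft (p.1 + p.2)).tsum_eq D]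
    rfl
  simp only [h]
  rw [ENNReal.tsum_mul_right, ENNReal.tsum_prod']
  simp only [ENNReal.tsum_mul_left, ENNReal.tsum_mul_right]

theorem sobolevEnergy_cubicMajorant_le {s : ℝ} (hs : 0 ≤ s) (F G H : ℤ → ℝ≥0∞) :
    sobolevEnergy s (cubicMajorant F G H) ≤
      (∑' m, invKernel m ^ 2) ^ 2 * ENNReal.ofReal (9 ^ s) *
        (sobolevEnergy s F * (∑' n, G n ^ 2) * (∑' n, H n ^ 2) +
          (∑' n, F n ^ 2) * sobolevEnergy s G * (∑' n, H n ^ 2) +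
          (∑' n, F n ^ 2) * (∑' n, G n ^ 2) * sobolevEnergy s H) := by
  simp only [sobolevEnergy]
  rw [← tsum_tsum_add_sub, ← tsum_tsum_add_sub, ← tsum_tsum_add_sub, ← ENNReal.tsum_add,
    ← ENNReal.tsum_add, ← ENNReal.tsum_mul_left]
  refine ENNReal.tsum_le_tsum fun n => ?_
  rw [← ENNReal.tsum_add, ← ENNReal.tsum_add, mul_assoc]
  calc sobolevWeight s n * cubicMajorant F G H n ^ 2
      ≤ sobolevWeight s n * ((∑' m, invKernel m ^ 2) ^ 2 *
          ∑' p : ℤ × ℤ, (F p.1 * G p.2 * H (p.1 + p.2 - n)) ^ 2) := by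
        gcongr; exact cubicMajorant_sq_le F G H n
    _ = (∑' m, invKernel m ^ 2) ^ 2 *
          ∑' p : ℤ × ℤ, sobolevWeight s n * (F p.1 * G p.2 * H (p.1 + p.2 - n)) ^ 2 := by
        rw [ENNReal.tsum_mul_left]; ring
    _ ≤ _ := by
        refine mul_le_mul' le_rfl ?_
        rw [← ENNReal.tsum_mul_left]
        refine ENNReal.tsum_le_tsum fun p => ?_
        have h := sobolevWeight_add_sub_le hs p.1 p.2 (p.1 + p.2 - n)
        rw [sub_sub_cancel] at h
        refine (mul_le_mul_left h _).trans (le_of_eq ?_)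
        ring

theorem sobolevEnergy_cubicMajorant_le_energy {s : ℝ} (hs : 0 ≤ s) (F G H : ℤ → ℝ≥0∞) :
    sobolevEnergy s (cubicMajorant F G H) ≤
      3 * ((∑' m, invKernel m ^ 2) ^ 2 * ENNReal.ofReal (9 ^ s)) *
        (sobolevEnergy s F * sobolevEnergy s G * sobolevEnergy s H) := by
  refine (sobolevEnergy_cubicMajorant_le hs F G H).trans ?_
  have hF := tsum_sq_le_sobolevEnergy s F
  have hG := tsum_sq_le_sobolevEnergy s G
  have hH := tsum_sq_le_sobolevEnergy s H
  calc _ ≤ (∑' m, invKernel m ^ 2) ^ 2 * ENNReal.ofReal (9 ^ s) *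
        (sobolevEnergy s F * sobolevEnergy s G * sobolevEnergy s H +
          sobolevEnergy s F * sobolevEnergy s G * sobolevEnergy s H +
          sobolevEnergy s F * sobolevEnergy s G * sobolevEnergy s H) := by gcongr
    _ = _ := by ring

theorem res_one (p q n : ℤ) :
    res 1 p q (p + q - n) = -2 * ((p - n : ℤ) : ℝ) * ((q - n : ℤ) : ℝ) := by
  unfold res
  norm_num
  ring

theorem enorm_div_res_one_le {σ : ℝ} (hσ : σ = 1 ∨ σ = -1) (p q n : ℤ) :
    ‖((-σ / res 1 p q (p + q - n) : ℝ) : ℂ)‖ₑ ≤ invKernel (p - n) * invKernel (q - n) := by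
  have h : ‖((-σ / res 1 p q (p + q - n) : ℝ) : ℂ)‖ ≤
      ‖(((p - n : ℤ) : ℝ))⁻¹ * (((q - n : ℤ) : ℝ))⁻¹‖ := by
    have hσ' : |σ| = 1 := by rcases hσ with rfl | rfl <;> simp
    rw [Complex.norm_real, res_one, norm_div, norm_neg, Real.norm_eq_abs σ, hσ', norm_mul, norm_mul,
      norm_mul, norm_inv, norm_inv, one_div, mul_inv, mul_inv, mul_assoc]
    refine mul_le_of_le_one_left (by positivity) (by norm_num)
  rw [invKernel, invKernel, ← enorm_mul, ← ofReal_norm, ← ofReal_norm]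
  exact ENNReal.ofReal_le_ofReal h

theorem enorm_birkhoffTerm_le {σ : ℝ} (hσ : σ = 1 ∨ σ = -1) (N : ℕ∞) (u : ℤ → ℂ) (n : ℤ)
    (p : ℤ × ℤ) :
    ‖birkhoffTerm 1 σ N u n p‖ₑ ≤ invKernel (p.1 - n) * invKernel (p.2 - n) *
      (‖u p.1‖ₑ * ‖u p.2‖ₑ * ‖u (p.1 + p.2 - n)‖ₑ) := by
  unfold birkhoffTerm
  split_ifs
  · rw [enorm_mul, enorm_mul, enorm_mul, RCLike.enorm_conj]
    gcongr
    exact enorm_div_res_one_le hσ p.1 p.2 n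
  · simp

theorem enorm_birkhoffTerm_sub_le {σ : ℝ} (hσ : σ = 1 ∨ σ = -1) (N : ℕ∞) (u v : ℤ → ℂ) (n : ℤ)
    (p : ℤ × ℤ) :
    ‖birkhoffTerm 1 σ N u n p - birkhoffTerm 1 σ N v n p‖ₑ ≤
      invKernel (p.1 - n) * invKernel (p.2 - n) *
          (‖u p.1 - v p.1‖ₑ * ‖u p.2‖ₑ * ‖u (p.1 + p.2 - n)‖ₑ) +
        invKernel (p.1 - n) * invKernel (p.2 - n) *
          (‖v p.1‖ₑ * ‖u p.2 - v p.2‖ₑ * ‖u (p.1 + p.2 - n)‖ₑ) +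
        invKernel (p.1 - n) * invKernel (p.2 - n) *
          (‖v p.1‖ₑ * ‖v p.2‖ₑ * ‖u (p.1 + p.2 - n) - v (p.1 + p.2 - n)‖ₑ) := by
  unfold birkhoffTerm
  split_ifs
  · have h : ∀ a b c a' b' c' : ℂ, a * b * conj c - a' * b' * conj c' =
        (a - a') * b * conj c + a' * (b - b') * conj c + a' * b' * conj (c - c') := by
      intros
      rw [map_sub]
      ring
    rw [← mul_sub, enorm_mul, h, ← mul_add, ← mul_add]
    refine mul_le_mul' (enorm_div_res_one_le hσ p.1 p.2 n) ?_
    refine (enorm_add_le _ _).trans (add_le_add ((enorm_add_le _ _).trans ?_) ?_) <;>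
      simp only [enorm_mul, RCLike.enorm_conj, le_refl]
  · simp

theorem enorm_XB_le {σ : ℝ} (hσ : σ = 1 ∨ σ = -1) (N : ℕ∞) (u : ℤ → ℂ) (n : ℤ) :
    ‖XB 1 σ N u n‖ₑ ≤
      cubicMajorant (fun n => ‖u n‖ₑ) (fun n => ‖u n‖ₑ) (fun n => ‖u n‖ₑ) n := by
  rw [XB_eq_tsum]
  split_ifs
  · exact enorm_tsum_le_tsum_enorm.trans
      (ENNReal.tsum_le_tsum fun p => enorm_birkhoffTerm_le hσ N u n p)
  · simp

theorem cubicConstant_ne_top (s : ℝ) :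
    (∑' m, invKernel m ^ 2) ^ 2 * ENNReal.ofReal (9 ^ s) ≠ ⊤ :=
  ENNReal.mul_ne_top (ENNReal.pow_ne_top tsum_invKernel_sq_ne_top) ENNReal.ofReal_ne_top

theorem cubicMajorant_ne_top {s : ℝ} (hs : 0 ≤ s) {F G H : ℤ → ℝ≥0∞}
    (hF : sobolevEnergy s F ≠ ⊤) (hG : sobolevEnergy s G ≠ ⊤) (hH : sobolevEnergy s H ≠ ⊤)
    (n : ℤ) : cubicMajorant F G H n ≠ ⊤ := by
  have h := (le_sobolevEnergy s _ n).trans (sobolevEnergy_cubicMajorant_le_energy hs F G H)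
  have hfin := ne_top_of_le_ne_top (ENNReal.mul_ne_top (ENNReal.mul_ne_top (by norm_num)
    (cubicConstant_ne_top s)) (ENNReal.mul_ne_top (ENNReal.mul_ne_top hF hG) hH)) h
  intro htop
  simp [htop] at hfin

theorem summable_birkhoffTerm {s σ : ℝ} (hs : 0 ≤ s) (hσ : σ = 1 ∨ σ = -1) (N : ℕ∞)
    {u : ℤ → ℂ} (hu : sobolevEnergy s (fun n => ‖u n‖ₑ) ≠ ⊤) (n : ℤ) :
    Summable (birkhoffTerm 1 σ N u n) := by
  refine Summable.of_enorm ?_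
  exact ne_top_of_le_ne_top (cubicMajorant_ne_top hs hu hu hu n)
    (ENNReal.tsum_le_tsum fun p => enorm_birkhoffTerm_le hσ N u n p)

theorem enorm_XB_sub_le {s σ : ℝ} (hs : 0 ≤ s) (hσ : σ = 1 ∨ σ = -1) (N : ℕ∞) {u v : ℤ → ℂ}
    (hu : sobolevEnergy s (fun n => ‖u n‖ₑ) ≠ ⊤) (hv : sobolevEnergy s (fun n => ‖v n‖ₑ) ≠ ⊤)
    (n : ℤ) :
    ‖XB 1 σ N u n - XB 1 σ N v n‖ₑ ≤
      cubicMajorant (fun n => ‖u n - v n‖ₑ) (fun n => ‖u n‖ₑ) (fun n => ‖u n‖ₑ) n +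
        cubicMajorant (fun n => ‖v n‖ₑ) (fun n => ‖u n - v n‖ₑ) (fun n => ‖u n‖ₑ) n +
        cubicMajorant (fun n => ‖v n‖ₑ) (fun n => ‖v n‖ₑ) (fun n => ‖u n - v n‖ₑ) n := by
  rw [XB_eq_tsum, XB_eq_tsum]
  split_ifs
  · rw [← (summable_birkhoffTerm hs hσ N hu n).tsum_sub (summable_birkhoffTerm hs hσ N hv n)]
    refine enorm_tsum_le_tsum_enorm.trans ?_
    simp only [cubicMajorant]
    rw [← ENNReal.tsum_add, ← ENNReal.tsum_add]
    exact ENNReal.tsum_le_tsum fun p => enorm_birkhoffTerm_sub_le hσ N u v n p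
  · simp

/-- Estimates for the Birkhoff vector field `X_N` in the case `α = 1`. -/
theorem statement_3 (s : ℝ) (hs : 0 ≤ s) :
    ∃ C : ℝ, 0 < C ∧ ∀ σ : ℝ, (σ = 1 ∨ σ = -1) → ∀ N : ℕ∞, ∀ u v : ℤ → ℂ,
      hsE s u ≠ ⊤ → hsE s v ≠ ⊤ →
      hsE s (XB 1 σ N u) ≤ ENNReal.ofReal C * hsE 0 u ^ 2 * hsE s u ∧
      hsE s (fun n => XB 1 σ N u n - XB 1 σ N v n)
        ≤ ENNReal.ofReal C * hsE s (fun n => u n - v n) * (hsE s u ^ 2 + hsE s v ^ 2) := by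
  set M : ℝ≥0∞ := (∑' m, invKernel m ^ 2) ^ 2 * ENNReal.ofReal (9 ^ s) with hM
  have hC : 27 * M + 1 ≠ ⊤ := by
    have := ENNReal.mul_ne_top (by norm_num : (27 : ℝ≥0∞) ≠ ⊤) (cubicConstant_ne_top s)
    exact ENNReal.add_ne_top.2 ⟨this, ENNReal.one_ne_top⟩
  refine ⟨(27 * M + 1).toReal, ENNReal.toReal_pos (by simp) hC, ?_⟩
  rw [ENNReal.ofReal_toReal hC]
  have hMC : 27 * M ≤ (27 * M + 1) ^ 2 :=
    le_self_add.trans (le_self_pow₀ le_add_self two_ne_zero)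
  intro σ hσ N u v hu hv
  have hu' : sobolevEnergy s (fun n => ‖u n‖ₑ) ≠ ⊤ := by
    rw [← hsE_sq_s3]; exact ENNReal.pow_ne_top hu
  have hv' : sobolevEnergy s (fun n => ‖v n‖ₑ) ≠ ⊤ := by
    rw [← hsE_sq_s3]; exact ENNReal.pow_ne_top hv
  constructor
  · rw [← ENNReal.pow_le_pow_left_iff two_ne_zero]
    have h0 := tsum_sq_le_sobolevEnergy 0 (fun n => ‖u n‖ₑ)
    calc hsE s (XB 1 σ N u) ^ 2
        ≤ sobolevEnergy s
            (cubicMajorant (fun n => ‖u n‖ₑ) (fun n => ‖u n‖ₑ) (fun n => ‖u n‖ₑ)) := by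
          rw [hsE_sq_s3]; exact sobolevEnergy_mono s (enorm_XB_le hσ N u)
      _ ≤ M * (hsE s u ^ 2 * hsE 0 u ^ 2 * hsE 0 u ^ 2 +
            hsE 0 u ^ 2 * hsE s u ^ 2 * hsE 0 u ^ 2 +
            hsE 0 u ^ 2 * hsE 0 u ^ 2 * hsE s u ^ 2) := by
          refine (sobolevEnergy_cubicMajorant_le hs _ _ _).trans ?_
          rw [hsE_sq_s3, hsE_sq_s3]
          gcongr
      _ = 3 * M * ((hsE 0 u ^ 2) ^ 2 * hsE s u ^ 2) := by ring
      _ ≤ 27 * M * ((hsE 0 u ^ 2) ^ 2 * hsE s u ^ 2) := by gcongr; norm_num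
      _ ≤ (27 * M + 1) ^ 2 * ((hsE 0 u ^ 2) ^ 2 * hsE s u ^ 2) := by gcongr
      _ = ((27 * M + 1) * hsE 0 u ^ 2 * hsE s u) ^ 2 := by ring
  · rw [← ENNReal.pow_le_pow_left_iff two_ne_zero]
    set a := hsE s u ^ 2 with ha
    set b := hsE s v ^ 2 with hb
    set d := hsE s (fun n => u n - v n) with hd
    have ha' : a ≤ a + b := le_self_add
    have hb' : b ≤ a + b := le_add_self
    calc hsE s (fun n => XB 1 σ N u n - XB 1 σ N v n) ^ 2
        ≤ 3 * (3 * M * (d ^ 2 * a * a) + 3 * M * (b * d ^ 2 * a) + 3 * M * (b * b * d ^ 2)) := by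
          rw [hsE_sq_s3]
          refine (sobolevEnergy_mono s (enorm_XB_sub_le hs hσ N hu' hv')).trans ?_
          refine (sobolevEnergy_add_add_le s _ _ _).trans ?_
          rw [ha, hb, hd, hsE_sq_s3, hsE_sq_s3, hsE_sq_s3]
          gcongr <;> exact sobolevEnergy_cubicMajorant_le_energy hs _ _ _
      _ ≤ 3 * (3 * M * (d ^ 2 * (a + b) * (a + b)) + 3 * M * ((a + b) * d ^ 2 * (a + b)) +
            3 * M * ((a + b) * (a + b) * d ^ 2)) := by gcongr
      _ = 27 * M * (d ^ 2 * (a + b) ^ 2) := by ring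
      _ ≤ (27 * M + 1) ^ 2 * (d ^ 2 * (a + b) ^ 2) := by gcongr
      _ = ((27 * M + 1) * d * (a + b)) ^ 2 := by ring

end
end
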